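/- Let t ≥ 1 and let s = (s_1,…,s_t) be a vector of positive integers. For a subset i = {i_1 < ⋯ < i_λ} ⊊ {1,…,t} (possibly empty) and integers j = (j_1,…,j_λ) with 0 ≤ j_a ≤ s_{i_a}, let Inf^t_i(j) ∈ ℤ^t be the vector whose i_a-th entry is j_a and whose other entries all equal 1, and set w(i,j) = |s| − |j| + λ − t, where |s| = s_1+⋯+s_t and |j| = j_1+⋯+j_λ. Then for all x ∈ ℝ: ∏_{τ=1}^t B_{s_τ}(x) = C_s + Σ_{i ⊊ {1,…,t}} Σ_{j : 0 ≤ j_a ≤ s_{i_a}} [ w(i,j)! / ∏_{τ=1}^t (s_τ − Inf^t_i(j)_τ)! ] · (∏_{a=1}^λ B_{j_a}/j_a!) · (s_1!⋯s_t!) · B_{w(i,j)+1}(x)/(w(i,j)+1)!, where C_s = Σ_{r_1=0}^{s_1} ⋯ Σ_{r_t=0}^{s_t} (∏_{τ=1}^t C(s_τ, r_τ)) · (∏_{τ=1}^t B_{s_τ − r_τ}) / (r_1+⋯+r_t+1), C denoting binomial coefficients. Moreover C_s = ∫_0^1 ∏_{τ=1}^t B_{s_τ}(x) dx. -/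

import Mathlib

/-- The `n`-th Bernoulli polynomial evaluated at a real `x`. -/
noncomputable def Bp (n : ℕ) (x : ℝ) : ℝ :=
  ((Polynomial.bernoulli n).map (algebraMap ℚ ℝ)).eval x

/-- The constant `C_s = Σ_{0 ≤ r ≤ s} (∏ C(s_τ,r_τ)) (∏ B_{s_τ−r_τ})/(|r|+1)`. -/
noncomputable def Cs {t : ℕ} (s : Fin t → ℕ) : ℝ :=
  ∑ r ∈ Fintype.piFinset (fun τ : Fin t => Finset.range (s τ + 1)),
    (∏ τ, ((s τ).choose (r τ) : ℝ)) * (∏ τ, (bernoulli (s τ - r τ) : ℝ)) /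
      (((∑ τ, r τ : ℕ) : ℝ) + 1)

open Finset in
theorem Bp_eq_sum (n : ℕ) (x : ℝ) :
    Bp n x = ∑ j ∈ range (n + 1), (n.choose j : ℝ) * bernoulli j * x ^ (n - j) := by
  simp only [Bp, Polynomial.bernoulli, Polynomial.map_sum, Polynomial.eval_finsetSum,
    Polynomial.map_monomial, Polynomial.eval_monomial]
  refine sum_congr rfl fun j _ => ?_
  simp only [eq_ratCast]
  push_cast
  ring

open Finset in
theorem Bp_eq_sum_reflect (n : ℕ) (x : ℝ) :
    Bp n x = ∑ r ∈ range (n + 1), (n.choose r : ℝ) * bernoulli (n - r) * x ^ r := by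
  rw [Bp_eq_sum, ← sum_range_reflect]
  refine sum_congr rfl fun j hj => ?_
  have hj : j ≤ n := by simpa [Nat.lt_succ_iff] using hj
  rw [Nat.add_sub_cancel, Nat.choose_symm hj, Nat.sub_sub_self hj]

theorem Bp_add_one (n : ℕ) (x : ℝ) : Bp n (x + 1) = Bp n x + n * x ^ (n - 1) := by
  have h := congrArg (fun p => (p.map (algebraMap ℚ ℝ)).eval x)
    (Polynomial.bernoulli_comp_one_add_X n)
  simpa [Bp, Polynomial.map_comp, add_comm x 1] using h

theorem continuous_Bp (n : ℕ) : Continuous (Bp n) :=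
  continuous_bernoulliFun n

theorem integral_Bp_succ (n : ℕ) : ∫ x in (0 : ℝ)..1, Bp (n + 1) x = 0 :=
  integral_bernoulliFun_eq_zero n.succ_ne_zero

open Finset in
theorem integral_prod_Bp {t : ℕ} (s : Fin t → ℕ) :
    ∫ x in (0 : ℝ)..1, ∏ τ, Bp (s τ) x = Cs s := by
  simp_rw [Bp_eq_sum_reflect, prod_univ_sum, prod_mul_distrib, prod_pow_eq_pow_sum]
  rw [intervalIntegral.integral_finsetSum
    fun r _ => Continuous.intervalIntegrable (by fun_prop) _ _]
  refine sum_congr rfl fun r _ => ?_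
  rw [intervalIntegral.integral_const_mul, integral_pow]
  simp [div_eq_mul_inv]

/-- A real polynomial function of period one is constant. -/
theorem Polynomial.eval_eq_eval_zero_of_periodic (p : Polynomial ℝ)
    (h : ∀ x, p.eval (x + 1) = p.eval x) (x : ℝ) : p.eval x = p.eval 0 := by
  have hn : ∀ n : ℕ, p.eval (n : ℝ) = p.eval 0 := fun n => by
    induction n with
    | zero => simp
    | succ k ih => rw [Nat.cast_succ, h, ih]
  have hp : p = Polynomial.C (p.eval 0) := by
    refine Polynomial.eq_of_infinite_eval_eq _ _ ?_
    refine (Set.infinite_range_of_injective (Nat.cast_injective (R := ℝ))).mono ?_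
    rintro _ ⟨n, rfl⟩
    simp [hn]
  rw [hp]
  simp

/-- The vector with entries `j` on `i` and `1` elsewhere. -/
def infVec {t : ℕ} (i : Finset (Fin t)) (j : ∀ a ∈ i, ℕ) (τ : Fin t) : ℕ :=
  if h : τ ∈ i then j τ h else 1

/-- The weight `|s| + λ - |j| - t`. -/
def infWeight {t : ℕ} (s : Fin t → ℕ) (i : Finset (Fin t)) (j : ∀ a ∈ i, ℕ) : ℕ :=
  (∑ τ, s τ) + i.card - ((∑ a ∈ i.attach, j a.1 a.2) + t)

/-- The coefficient of `B_{w+1}(x)` in the expansion of the product. -/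
noncomputable def infCoeff {t : ℕ} (s : Fin t → ℕ) (i : Finset (Fin t)) (j : ∀ a ∈ i, ℕ) : ℝ :=
  (((infWeight s i j).factorial : ℝ) / ∏ τ, ((s τ - infVec i j τ).factorial : ℝ)) *
    (∏ a ∈ i.attach, (bernoulli (j a.1 a.2) : ℝ) / ((j a.1 a.2).factorial : ℝ)) *
      ((∏ τ, ((s τ).factorial : ℝ)) / ((infWeight s i j + 1).factorial : ℝ))

open Finset in
theorem prod_attach_eq_prod_infVec {t : ℕ} {M : Type*} [CommMonoid M] (i : Finset (Fin t))
    (j : ∀ a ∈ i, ℕ) (F : Fin t → ℕ → M) :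
    ∏ a ∈ i.attach, F a.1 (j a.1 a.2) = ∏ a ∈ i, F a (infVec i j a) := by
  rw [← prod_attach i]
  refine prod_congr rfl fun a _ => ?_
  simp [infVec]

open Finset in
theorem infWeight_eq_sum {t : ℕ} {s : Fin t → ℕ} (hs : ∀ τ, 1 ≤ s τ) {i : Finset (Fin t)}
    {j : ∀ a ∈ i, ℕ} (hj : ∀ a h, j a h ≤ s a) :
    infWeight s i j = ∑ τ, (s τ - infVec i j τ) := by
  have hle : ∀ τ, infVec i j τ ≤ s τ := fun τ => by
    unfold infVec
    split_ifs with h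
    exacts [hj τ h, hs τ]
  have h₁ : ∑ a ∈ i.attach, j a.1 a.2 = ∑ a ∈ i, infVec i j a := by
    rw [← sum_attach i]
    exact sum_congr rfl fun a _ => by simp [infVec]
  have h₂ : ∑ a ∈ iᶜ, infVec i j a = iᶜ.card := by
    rw [card_eq_sum_ones]
    exact sum_congr rfl fun a ha => by simp [infVec, mem_compl.1 ha]
  have h₃ := sum_add_sum_compl i (infVec i j)
  have h₄ : ∑ τ, (s τ - infVec i j τ) + ∑ τ, infVec i j τ = ∑ τ, s τ := by
    rw [← sum_add_distrib]
    exact sum_congr rfl fun a _ => Nat.sub_add_cancel (hle a)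
  have h₅ : i.card + iᶜ.card = t := by simp
  unfold infWeight
  omega

open Finset in
theorem infCoeff_mul_pow {t : ℕ} {s : Fin t → ℕ} (hs : ∀ τ, 1 ≤ s τ) {i : Finset (Fin t)}
    {j : ∀ a ∈ i, ℕ} (hj : ∀ a h, j a h ≤ s a) (x : ℝ) :
    infCoeff s i j * (((infWeight s i j + 1 : ℕ) : ℝ) * x ^ infWeight s i j) =
      (∏ a ∈ i.attach, ((s a.1).choose (j a.1 a.2) : ℝ) * bernoulli (j a.1 a.2) *
        x ^ (s a.1 - j a.1 a.2)) * ∏ τ ∈ iᶜ, (s τ : ℝ) * x ^ (s τ - 1) := by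
  have hx : x ^ infWeight s i j = ∏ τ, x ^ (s τ - infVec i j τ) := by
    rw [infWeight_eq_sum hs hj, prod_pow_eq_pow_sum]
  have hc : infCoeff s i j * ((infWeight s i j + 1 : ℕ) : ℝ) =
      (∏ τ, ((s τ).factorial : ℝ) / ((s τ - infVec i j τ).factorial : ℝ)) *
        ∏ a ∈ i, (bernoulli (infVec i j a) : ℝ) / ((infVec i j a).factorial : ℝ) := by
    rw [infCoeff, prod_attach_eq_prod_infVec i j
      (fun _ m => (bernoulli m : ℝ) / (m.factorial : ℝ)), prod_div_distrib (s := univ), Nat.factorial_succ]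
    have h₁ : ((infWeight s i j).factorial : ℝ) ≠ 0 := by positivity
    have h₂ : ((infWeight s i j + 1 : ℕ) : ℝ) ≠ 0 := by positivity
    rw [Nat.cast_mul]
    field_simp
  rw [← mul_assoc, hc, hx, mul_right_comm, ← prod_mul_distrib, ← prod_mul_prod_compl i,
    mul_right_comm, ← prod_mul_distrib,
    prod_attach_eq_prod_infVec i j fun a m => ((s a).choose m : ℝ) * bernoulli m * x ^ (s a - m)]
  congr 1
  · refine prod_congr rfl fun a ha => ?_
    have hle : infVec i j a ≤ s a := by simpa [infVec, ha] using hj a ha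
    rw [Nat.cast_choose ℝ hle]
    field_simp
  · refine prod_congr rfl fun a ha => ?_
    have h1 : infVec i j a = 1 := by simp [infVec, mem_compl.1 ha]
    rw [h1, ← Nat.mul_factorial_pred (Nat.one_le_iff_ne_zero.1 (hs a)), Nat.cast_mul]
    field_simp

open Finset in
theorem prod_Bp_add_one {t : ℕ} {s : Fin t → ℕ} (hs : ∀ τ, 1 ≤ s τ) (x : ℝ) :
    ∏ τ, Bp (s τ) (x + 1) = ∏ τ, Bp (s τ) x +
      ∑ i ∈ univ.filter (fun i : Finset (Fin t) => i ≠ univ),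
        ∑ j ∈ i.pi (fun a => range (s a + 1)),
          infCoeff s i j * (((infWeight s i j + 1 : ℕ) : ℝ) * x ^ infWeight s i j) := by
  simp_rw [Bp_add_one]
  rw [Fintype.prod_add, filter_ne', ← add_sum_erase _ _ (mem_univ univ)]
  congr 1
  · simp
  · refine sum_congr rfl fun i _ => ?_
    simp_rw [Bp_eq_sum]
    rw [prod_sum, sum_mul]
    refine sum_congr rfl fun j hj => (infCoeff_mul_pow hs (fun a h => ?_) x).symm
    exact Nat.lt_succ_iff.1 (mem_range.1 (mem_pi.1 hj a h))

open Finset in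
theorem prod_Bp_eq {t : ℕ} {s : Fin t → ℕ} (hs : ∀ τ, 1 ≤ s τ) (x : ℝ) :
    ∏ τ, Bp (s τ) x = Cs s +
      ∑ i ∈ univ.filter (fun i : Finset (Fin t) => i ≠ univ),
        ∑ j ∈ i.pi (fun a => range (s a + 1)), infCoeff s i j * Bp (infWeight s i j + 1) x := by
  set R : ℝ → ℝ := fun x => ∑ i ∈ univ.filter (fun i : Finset (Fin t) => i ≠ univ),
    ∑ j ∈ i.pi (fun a => range (s a + 1)), infCoeff s i j * Bp (infWeight s i j + 1) x with hR
  let b : ℕ → Polynomial ℝ := fun n => (Polynomial.bernoulli n).map (algebraMap ℚ ℝ)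
  let p : Polynomial ℝ := ∏ τ, b (s τ) - ∑ i ∈ univ.filter (fun i : Finset (Fin t) => i ≠ univ),
    ∑ j ∈ i.pi (fun a => range (s a + 1)),
      Polynomial.C (infCoeff s i j) * b (infWeight s i j + 1)
  have hp : ∀ y, p.eval y = ∏ τ, Bp (s τ) y - R y := fun y => by
    simp [p, b, hR, Bp, Polynomial.eval_finsetSum, Polynomial.eval_prod]
  have hconst := p.eval_eq_eval_zero_of_periodic fun y => by
    rw [hp, hp, prod_Bp_add_one hs]
    simp only [hR, Bp_add_one, Nat.add_sub_cancel, mul_add, sum_add_distrib]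
    ring
  have hcont (i : Finset (Fin t)) (j : ∀ a ∈ i, ℕ) :
      Continuous fun y => infCoeff s i j * Bp (infWeight s i j + 1) y :=
    continuous_const.mul (continuous_Bp _)
  have hRcont : Continuous R :=
    continuous_finsetSum _ fun i _ => continuous_finsetSum _ fun j _ => hcont i j
  have hRint : ∫ y in (0 : ℝ)..1, R y = 0 := by
    rw [hR, intervalIntegral.integral_finsetSum fun i _ =>
      (continuous_finsetSum _ fun j _ => hcont i j).intervalIntegrable _ _]
    refine sum_eq_zero fun i _ => ?_
    rw [intervalIntegral.integral_finsetSum fun j _ => (hcont i j).intervalIntegrable _ _]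
    refine sum_eq_zero fun j _ => ?_
    rw [intervalIntegral.integral_const_mul, integral_Bp_succ, mul_zero]
  have hprod : ∀ y, ∏ τ, Bp (s τ) y = p.eval 0 + R y := fun y => by
    rw [← hconst y, hp, sub_add_cancel]
  have hC : Cs s = p.eval 0 := by
    rw [← integral_prod_Bp]
    simp_rw [hprod]
    rw [intervalIntegral.integral_add (by simp) (hRcont.intervalIntegrable _ _), hRint]
    simp
  rw [hprod, hC]


theorem stmt8 (t : ℕ) (ht : 1 ≤ t) (s : Fin t → ℕ) (hs : ∀ τ, 1 ≤ s τ) :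
    (∀ x : ℝ,
      ∏ τ, Bp (s τ) x
        = Cs s + ∑ i ∈ Finset.univ.filter (fun i : Finset (Fin t) => i ≠ Finset.univ),
            ∑ j ∈ i.pi (fun a => Finset.range (s a + 1)),
              (let Infm : Fin t → ℕ := fun τ => if h : τ ∈ i then j τ h else 1;
               let w : ℕ := (∑ τ, s τ) + i.card - ((∑ a ∈ i.attach, j a.1 a.2) + t);
               ((w.factorial : ℝ) / ∏ τ, ((s τ - Infm τ).factorial : ℝ)) *
                 (∏ a ∈ i.attach, (bernoulli (j a.1 a.2) : ℝ) / ((j a.1 a.2).factorial : ℝ)) *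
                   ((∏ τ, ((s τ).factorial : ℝ)) * Bp (w + 1) x / ((w + 1).factorial : ℝ))))
    ∧ (∫ x in (0 : ℝ)..1, ∏ τ, Bp (s τ) x) = Cs s := by
  refine ⟨fun x => ?_, integral_prod_Bp s⟩
  rw [prod_Bp_eq hs x]
  congr 1
  refine Finset.sum_congr rfl fun i _ => Finset.sum_congr rfl fun j _ => ?_
  simp only [infCoeff, infWeight, infVec]
  ring
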